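/- For every real d with 0.293 ≤ d ≤ 0.294, the quantity (π + d) / √(4 + d² + 4·d·cos 1) is strictly greater than 1.5810528. -/

import Mathlib

open Real

/-- A seven-digit upper bound for `cos 1`, from the Taylor polynomial of `exp` at `I`. -/
lemma cos_one_lt_d7 : Real.cos 1 < 0.5403024 := by
  have h := Complex.exp_bound (x := Complex.I) (by simp) (n := 12) (by norm_num)
  have hre := (abs_le.mp ((Complex.abs_re_le_norm _).trans h)).2
  have hexp : (Complex.exp Complex.I).re = Real.cos 1 := by
    simpa using Complex.exp_ofReal_mul_I_re 1
  have hsum : (∑ m ∈ Finset.range 12, Complex.I ^ m / (m.factorial : ℂ)).re =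
      1 - 1 / 2 + 1 / 24 - 1 / 720 + 1 / 40320 - 1 / 3628800 := by
    simp only [Finset.sum_range_succ, Finset.sum_range_zero]
    norm_num [Nat.factorial, pow_succ]
  rw [Complex.sub_re, hexp, hsum, Complex.norm_I] at hre
  norm_num [Nat.factorial] at hre ⊢
  linarith

/-- For every `d ∈ [0.293, 0.294]`, the limiting dilation
`(π + d) / √(4 + d² + 4 d cos 1)` of the two-semicircle construction
exceeds `1.5810528`. -/
theorem dilation_gt_on_interval (d : ℝ) (h1 : 0.293 ≤ d) (h2 : d ≤ 0.294) :
    (π + d) / Real.sqrt (4 + d ^ 2 + 4 * d * Real.cos 1) > 1.5810528 := by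
  have hpi := Real.pi_gt_d20
  have hcos := cos_one_lt_d7
  have hd : 0 < d := by linarith
  have hrad : 4 + d ^ 2 + 4 * d * Real.cos 1 < ((π + d) / 1.5810528) ^ 2 := by
    calc 4 + d ^ 2 + 4 * d * Real.cos 1 < 4 + d ^ 2 + 4 * d * 0.5403024 := by gcongr
      _ < ((3.1415926535 + d) / 1.5810528) ^ 2 := by
        have hchord := mul_nonneg (sub_nonneg.2 h1) (sub_nonneg.2 h2)
        rw [div_pow, lt_div_iff₀ (by norm_num)]
        norm_num at h1 h2 hchord ⊢
        nlinarith only [h1, h2, hchord]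
      _ ≤ ((π + d) / 1.5810528) ^ 2 := by
        gcongr
        linarith
  have hpos : 0 < 4 + d ^ 2 + 4 * d * Real.cos 1 := by
    have := Real.cos_one_pos
    positivity
  rw [gt_iff_lt, lt_div_iff₀ (Real.sqrt_pos.2 hpos), mul_comm, ← lt_div_iff₀ (by norm_num),
    Real.sqrt_lt' (by positivity)]
  exact hrad
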